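/- There exists ε₀ > 0, depending only on S and k, such that for every k-fission H of S within any ε ≤ ε₀ the following holds: if v and w are two distinct points of S such that {v,w} is NOT a halving edge of S, then no halving edge of H traverses the v-cluster and the w-cluster. -/

import Mathlib

noncomputable section

/-- The plane. -/
abbrev Pt : Type := EuclideanSpace ℝ (Fin 2)

/-- Signed determinant of the triple `(p, q, r)`: positive iff `r` lies on the left of
the directed line from `p` to `q`. -/
def det2 (p q r : Pt) : ℝ :=
  (q 0 - p 0) * (r 1 - p 1) - (q 1 - p 1) * (r 0 - p 0)

/-- A finite set of points in the plane is in general position if no three of its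
(distinct) points are collinear. -/
def GenPos (S : Finset Pt) : Prop :=
  ∀ p ∈ S, ∀ q ∈ S, ∀ r ∈ S, p ≠ q → p ≠ r → q ≠ r →
    ¬ Collinear ℝ ({p, q, r} : Set Pt)

/-- `{p, q}` is a halving edge of `S`: `p, q` are distinct points of `S` and the open
half-planes on the two sides of the line through `p` and `q` each contain exactly
`(|S| - 2)/2` points of `S`. -/
def HalvingEdge (S : Finset Pt) (p q : Pt) : Prop :=
  p ∈ S ∧ q ∈ S ∧ p ≠ q ∧
    {r ∈ (S : Set Pt) | 0 < det2 p q r}.ncard = (S.card - 2) / 2 ∧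
    {r ∈ (S : Set Pt) | det2 p q r < 0}.ncard = (S.card - 2) / 2

/-- The halving edges graph of `S` (as a graph on the whole plane; all vertices
outside `S` are isolated). -/
def halvingGraph (S : Finset Pt) : SimpleGraph Pt :=
  SimpleGraph.fromRel (HalvingEdge S)

/-- The number of halving edges of `S`. -/
def halvingEdgeCount (S : Finset Pt) : ℕ :=
  {e : Sym2 Pt | ∃ p q, e = s(p, q) ∧ HalvingEdge S p q}.ncard

/-- `H`, together with the cluster map `cl`, is a `k`-fission of `S` within `ε`:
`H` is a set of `k * |S|` points in general position partitioned into clusters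
`cl v` of `k` points, one for each `v ∈ S`, with each point of the `v`-cluster
within distance `ε` of `v`. -/
structure IsFission (S : Finset Pt) (k : ℕ) (ε : ℝ) (H : Finset Pt)
    (cl : Pt → Finset Pt) : Prop where
  genPos : GenPos H
  cluster_card : ∀ v ∈ S, (cl v).card = k
  disj : ∀ v ∈ S, ∀ w ∈ S, v ≠ w → Disjoint (cl v) (cl w)
  union_eq : (H : Set Pt) = ⋃ v ∈ S, (cl v : Set Pt)
  close : ∀ v ∈ S, ∀ x ∈ cl v, dist x v ≤ ε

/-- A fission is plain if no halving edge of `H` has both endpoints in the same cluster. -/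
def IsPlain (S : Finset Pt) (H : Finset Pt) (cl : Pt → Finset Pt) : Prop :=
  ∀ v ∈ S, ∀ p ∈ cl v, ∀ q ∈ cl v, ¬ HalvingEdge H p q


local instance : DecidableEq Pt := Classical.decEq _

theorem det2_swap (p q r : Pt) : det2 q p r = -det2 p q r := by
  unfold det2; ring

theorem HalvingEdge.symm {S : Finset Pt} {p q : Pt} (h : HalvingEdge S p q) :
    HalvingEdge S q p := by
  obtain ⟨hp, hq, hne, hl, hr⟩ := h
  refine ⟨hq, hp, hne.symm, ?_, ?_⟩
  · simpa only [det2_swap p q, neg_pos] using hr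
  · simpa only [det2_swap p q, neg_lt_zero] using hl

theorem collinear_of_det2_eq_zero {p q r : Pt} (hpq : p ≠ q) (h : det2 p q r = 0) :
    Collinear ℝ ({p, q, r} : Set Pt) := by
  rw [collinear_iff_of_mem (p₀ := p) (by simp)]
  refine ⟨q - p, ?_⟩
  have key : ∃ t : ℝ, r = t • (q - p) + p := by
    unfold det2 at h
    by_cases h0 : q 0 - p 0 = 0
    · have h1 : q 1 - p 1 ≠ 0 := by
        intro h1
        apply hpq
        ext i
        fin_cases i
        · exact (sub_eq_zero.1 h0).symm
        · exact (sub_eq_zero.1 h1).symm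
      refine ⟨(r 1 - p 1) / (q 1 - p 1), ?_⟩
      have hr : r 0 - p 0 = 0 := by
        rw [h0, zero_mul, zero_sub, neg_eq_zero] at h
        exact (mul_eq_zero.1 h).resolve_left h1
      ext i
      fin_cases i
      · simp [h0]; linarith
      · simp; field_simp; ring
    · refine ⟨(r 0 - p 0) / (q 0 - p 0), ?_⟩
      ext i
      fin_cases i
      · simp; field_simp; ring
      · simp; field_simp; linarith
  intro x hx
  simp only [Set.mem_insert_iff, Set.mem_singleton_iff] at hx
  rcases hx with rfl | rfl | rfl
  · exact ⟨0, by simp⟩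
  · exact ⟨1, by simp⟩
  · simpa using key

/-- The orientation of a positively oriented triple of points of `S` is stable under
small perturbations, uniformly over all triples. -/
theorem exists_pos_det2_stable (S : Finset Pt) :
    ∃ ε₀ > 0, ∀ v ∈ S, ∀ w ∈ S, ∀ u ∈ S, 0 < det2 v w u →
      ∀ p q r : Pt, dist p v ≤ ε₀ → dist q w ≤ ε₀ → dist r u ≤ ε₀ → 0 < det2 p q r := by
  have key : ∀ᶠ ε : ℝ in nhdsWithin 0 (Set.Ioi 0), ∀ v ∈ S, ∀ w ∈ S, ∀ u ∈ S,
      0 < det2 v w u → ∀ p q r : Pt, dist p v ≤ ε → dist q w ≤ ε → dist r u ≤ ε →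
        0 < det2 p q r := by
    refine S.eventually_all.2 fun v _ => S.eventually_all.2 fun w _ =>
      S.eventually_all.2 fun u _ => ?_
    by_cases hd : 0 < det2 v w u
    · have hc : Continuous fun x : Pt × Pt × Pt => det2 x.1 x.2.1 x.2.2 := by
        unfold det2; fun_prop
      obtain ⟨δ, hδ, hball⟩ := Metric.eventually_nhds_iff.1
        (hc.continuousAt.eventually (lt_mem_nhds (a := 0) (b := det2 v w u) hd) :
          ∀ᶠ x in nhds ((v, w, u) : Pt × Pt × Pt), 0 < det2 x.1 x.2.1 x.2.2)
      filter_upwards [Ioo_mem_nhdsGT hδ] with ε hε _ p q r hp hq hr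
      refine hball (y := (p, q, r)) ?_
      rw [Prod.dist_eq, Prod.dist_eq]
      exact max_lt (hp.trans_lt hε.2) (max_lt (hq.trans_lt hε.2) (hr.trans_lt hε.2))
    · exact Filter.Eventually.of_forall fun _ h => absurd h hd
  obtain ⟨ε, h, hpos⟩ := (key.and self_mem_nhdsWithin).exists
  exact ⟨ε, hpos, h⟩

theorem ncard_sep_eq_card_filter (S : Finset Pt) (P : Pt → Prop) [DecidablePred P] :
    {r ∈ (S : Set Pt) | P r}.ncard = (S.filter P).card := by
  rw [← Set.ncard_coe_finset, Finset.coe_filter]; rfl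

theorem card_left_add_card_right {S : Finset Pt} (hS : GenPos S) {v w : Pt} (hv : v ∈ S)
    (hw : w ∈ S) (hvw : v ≠ w) :
    {r ∈ (S : Set Pt) | 0 < det2 v w r}.ncard +
      {r ∈ (S : Set Pt) | det2 v w r < 0}.ncard + 2 = S.card := by
  classical
  rw [ncard_sep_eq_card_filter, ncard_sep_eq_card_filter, ← Finset.card_union_of_disjoint,
    ← Finset.card_pair hvw, ← Finset.card_union_of_disjoint]
  · congr 1
    ext r
    simp only [Finset.mem_union, Finset.mem_filter, Finset.mem_insert, Finset.mem_singleton]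
    constructor
    · rintro ((h | h) | rfl | rfl)
      exacts [h.1, h.1, hv, hw]
    · intro hr
      by_cases h1 : r = v
      · exact Or.inr (Or.inl h1)
      by_cases h2 : r = w
      · exact Or.inr (Or.inr h2)
      rcases lt_trichotomy (det2 v w r) 0 with h | h | h
      · exact Or.inl (Or.inr ⟨hr, h⟩)
      · exact absurd (collinear_of_det2_eq_zero hvw h)
          (hS v hv w hw r hr hvw (Ne.symm h1) (Ne.symm h2))
      · exact Or.inl (Or.inl ⟨hr, h⟩)
  · rw [Finset.disjoint_left]
    intro r hr hr'
    simp only [Finset.mem_insert, Finset.mem_singleton] at hr'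
    have h0 : det2 v w r = 0 := by
      rcases hr' with rfl | rfl <;> unfold det2 <;> ring
    simp [h0] at hr
  · rw [Finset.disjoint_left]
    intro r hr hr'
    exact lt_asymm (Finset.mem_filter.1 hr).2 (Finset.mem_filter.1 hr').2

/-- A line through two points of `S` spanning no halving edge has at least half of the
points of `S` strictly on one of its sides. -/
theorem half_le_left_or_half_le_right {S : Finset Pt} (hS : GenPos S) (hcard : Even S.card)
    {v w : Pt} (hv : v ∈ S) (hw : w ∈ S) (hvw : v ≠ w) (h : ¬ HalvingEdge S v w) :
    S.card ≤ 2 * {r ∈ (S : Set Pt) | 0 < det2 v w r}.ncard ∨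
      S.card ≤ 2 * {r ∈ (S : Set Pt) | 0 < det2 w v r}.ncard := by
  have hadd := card_left_add_card_right hS hv hw hvw
  simp only [det2_swap v w, neg_pos]
  by_contra! hc
  obtain ⟨m, hm⟩ := hcard
  exact h ⟨hv, hw, hvw, by omega, by omega⟩

theorem IsFission.eq_biUnion [DecidableEq Pt] {S : Finset Pt} {k : ℕ} {ε : ℝ} {H : Finset Pt}
    {cl : Pt → Finset Pt} (hH : IsFission S k ε H cl) : H = S.biUnion cl := by
  apply Finset.coe_injective
  rw [hH.union_eq, Finset.coe_biUnion]
  rfl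

theorem IsFission.card_biUnion [DecidableEq Pt] {S : Finset Pt} {k : ℕ} {ε : ℝ}
    {H : Finset Pt} {cl : Pt → Finset Pt} (hH : IsFission S k ε H cl) {T : Finset Pt}
    (hT : T ⊆ S) : (T.biUnion cl).card = T.card * k := by
  rw [Finset.card_biUnion fun x hx y hy hxy => hH.disj x (hT hx) y (hT hy) hxy,
    Finset.sum_const_nat fun x hx => hH.cluster_card x (hT hx)]

/-- If at least half of the points of `S` lie to the left of `vw`, and orientations are
preserved, then points of the two clusters do not span a halving edge. -/
theorem IsFission.not_halvingEdge_of_half_le {S : Finset Pt} {k : ℕ} {ε : ℝ} {H : Finset Pt}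
    {cl : Pt → Finset Pt} (hH : IsFission S k ε H cl) (hk : 1 ≤ k) {v w p q : Pt}
    (hv : v ∈ S)
    (hhalf : S.card ≤ 2 * {r ∈ (S : Set Pt) | 0 < det2 v w r}.ncard)
    (hstable : ∀ u ∈ S, 0 < det2 v w u → ∀ r ∈ cl u, 0 < det2 p q r) :
    ¬ HalvingEdge H p q := by
  classical
  rintro ⟨-, -, -, hl, -⟩
  rw [ncard_sep_eq_card_filter] at hl hhalf
  set T := S.filter fun r => 0 < det2 v w r with hTdef
  have hT : T ⊆ S := Finset.filter_subset _ _
  have hsub : T.biUnion cl ⊆ H.filter fun r => 0 < det2 p q r := by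
    intro r hr
    obtain ⟨u, hu, hru⟩ := Finset.mem_biUnion.1 hr
    rw [Finset.mem_filter, hH.eq_biUnion]
    exact ⟨Finset.mem_biUnion.2 ⟨u, hT hu, hru⟩,
      hstable u (hT hu) (Finset.mem_filter.1 hu).2 r hru⟩
  have hle := Finset.card_le_card hsub
  have hHcard : H.card = S.card * k := by
    rw [← hH.card_biUnion subset_rfl, ← hH.eq_biUnion]
  rw [hH.card_biUnion hT, hl, hHcard] at hle
  have hpos : 0 < S.card * k := Nat.mul_pos (Finset.card_pos.2 ⟨v, hv⟩) hk
  have hmul : S.card * k ≤ 2 * (T.card * k) := by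
    rw [← mul_assoc]; exact Nat.mul_le_mul_right k hhalf
  omega

theorem stmt4 (S : Finset Pt) (hS : GenPos S) (hcard : Even S.card)
    (k : ℕ) (hk : 1 ≤ k) :
    ∃ ε₀ > 0, ∀ ε : ℝ, 0 < ε → ε ≤ ε₀ →
      ∀ (H : Finset Pt) (cl : Pt → Finset Pt), IsFission S k ε H cl →
        ∀ v ∈ S, ∀ w ∈ S, v ≠ w → ¬ HalvingEdge S v w →
          ∀ p ∈ cl v, ∀ q ∈ cl w, ¬ HalvingEdge H p q := by
  obtain ⟨ε₀, hε₀, hst⟩ := exists_pos_det2_stable S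
  refine ⟨ε₀, hε₀, ?_⟩
  intro ε _ hε H cl hH v hv w hw hvw hnot p hp q hq
  have hnear : ∀ u ∈ S, ∀ r ∈ cl u, dist r u ≤ ε₀ := fun u hu r hr =>
    (hH.close u hu r hr).trans hε
  rcases half_le_left_or_half_le_right hS hcard hv hw hvw hnot with h | h
  · exact hH.not_halvingEdge_of_half_le hk hv h fun u hu hd r hr =>
      hst v hv w hw u hu hd p q r (hnear v hv p hp) (hnear w hw q hq) (hnear u hu r hr)
  · intro he
    exact hH.not_halvingEdge_of_half_le hk hw h (fun u hu hd r hr =>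
      hst w hw v hv u hu hd q p r (hnear w hw q hq) (hnear v hv p hp) (hnear u hu r hr))
      he.symm

end
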